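/- An ideal J of a Boolean algebra B is simple if and only if it is principal, i.e. J = {b ∈ B | b ≤ a} for some a ∈ B. -/

import Mathlib

/-- A subset `I` of a lattice is an ideal: a nonempty lower set closed under finite joins. -/
def IsIdealSet {A : Type*} [Lattice A] (I : Set A) : Prop :=
  I.Nonempty ∧ (∀ a b : A, a ≤ b → b ∈ I → a ∈ I) ∧ ∀ a ∈ I, ∀ b ∈ I, a ⊔ b ∈ I

/-- The pseudocomplement of a set `J`: `¬J = {a | a ⊓ b = ⊥ for all b ∈ J}`. -/
def pseudoCompl {A : Type*} [Lattice A] [OrderBot A] (J : Set A) : Set A :=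
  {a : A | ∀ b ∈ J, a ⊓ b = ⊥}

/-- An ideal `J` is simple if every element of the lattice is the join of an element
of `J` and an element of `¬J`. -/
def IsSimpleSet {A : Type*} [Lattice A] [OrderBot A] (J : Set A) : Prop :=
  ∀ c : A, ∃ a ∈ J, ∃ b ∈ pseudoCompl J, c = a ⊔ b

/-- (M. Stone) An ideal of a Boolean algebra is simple iff it is principal. -/
theorem stmt2 {B : Type*} [BooleanAlgebra B] (J : Set B) (hJ : IsIdealSet J) :
    IsSimpleSet J ↔ ∃ a : B, J = {b : B | b ≤ a} := by
  constructor
  · intro h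
    obtain ⟨a, ha, b, hb, hab⟩ := h ⊤
    refine ⟨a, Set.Subset.antisymm (fun x hx => ?_) fun x hx => hJ.2.1 x a hx ha⟩
    have hbx : Disjoint x b := (disjoint_iff.mpr (hb x hx)).symm
    exact Disjoint.left_le_of_le_sup_right (hab ▸ le_top) hbx
  · rintro ⟨a, rfl⟩ c
    refine ⟨c ⊓ a, inf_le_right, c \ a, fun b hb => ?_, (sup_inf_sdiff c a).symm⟩
    exact (disjoint_sdiff_self_left.mono_right hb).eq_bot
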